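/- Let a ∈ ℂ with a ≠ 0 and suppose ζ·a + η·a + 1 ≠ 0 for all ζ, η ∈ ℂ with ζ⁵ = η⁵ = 1. Let M(λ) be the antisymmetric 5×5 matrix with rows (0, λ₂, −aλ₅, −aλ₁, λ₅), (−λ₂, 0, λ₄, −aλ₂, −aλ₃), (aλ₅, −λ₄, 0, λ₁, −aλ₄), (aλ₁, aλ₂, −λ₁, 0, λ₃), (−λ₅, aλ₃, aλ₄, −λ₃, 0), and for each m ∈ {1,…,5} let Pf_m(λ) denote the Pfaffian m_{ij}m_{kl} − m_{ik}m_{jl} + m_{il}m_{jk} of the principal 4×4 antisymmetric submatrix of M(λ) on the index set {i<j<k<l} = {1,…,5}∖{m}. If λ ∈ ℂ⁵ satisfies Pf_m(λ) = 0 for all m = 1,…,5, then all five partial derivatives of G(λ) = det(λ₁A₁ + … + λ₅A₅) (with parameters b = a) vanish at λ. (Thus the elliptic normal quintic C_E defined by the 4×4 Pfaffians of M(λ) is contained in the singular locus of the special Hessian quintic H_sp.) -/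

import Mathlib

open Matrix MvPolynomial

/-- The matrix `A_k` (for parameters `a`, `b`): `(A_k)_{k,k} = 1`, `(A_k)_{k,k+1} = b`,
`(A_k)_{k+1,k} = a`, indices cyclic mod 5, all other entries `0`. -/
noncomputable def Amat (a b : ℂ) (k : Fin 5) : Matrix (Fin 5) (Fin 5) ℂ :=
  fun i j =>
    (if i = k ∧ j = k then 1 else 0) + (if i = k ∧ j = k + 1 then b else 0) +
      (if i = k + 1 ∧ j = k then a else 0)

/-- The defining quintic `G(λ) = det(λ₁A₁ + ⋯ + λ₅A₅)` of the special Hessian quintic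
`H_sp` (parameters `b = a`), as a polynomial in the variables `λ_k`. -/
noncomputable def Gquintic (a : ℂ) : MvPolynomial (Fin 5) ℂ :=
  (Matrix.of fun i j => ∑ k : Fin 5, X k * C (Amat a a k i j)).det

/-- The antisymmetric 5×5 matrix `M(λ)` whose 4×4 Pfaffians cut out the elliptic normal
quintic `C_E` (here `λ₁,…,λ₅` are `l 0,…,l 4`). -/
noncomputable def Mpf (a : ℂ) (l : Fin 5 → ℂ) : Matrix (Fin 5) (Fin 5) ℂ :=
  !![0, l 1, -a * l 4, -a * l 0, l 4;
     -l 1, 0, l 3, -a * l 1, -a * l 2;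
     a * l 4, -l 3, 0, l 0, -a * l 3;
     a * l 0, a * l 1, -l 0, 0, l 2;
     -l 4, a * l 2, a * l 3, -l 2, 0]

/-- The explicit expansion of the special Hessian quintic. -/
lemma Gquintic_eq (a : ℂ) :
    Gquintic a = C (1 + 2 * a ^ 5) * (X 0 * X 1 * X 2 * X 3 * X 4)
      - C (a ^ 2) * (X 0 ^ 2 * X 2 * X 3 * X 4 + X 1 ^ 2 * X 3 * X 4 * X 0
          + X 2 ^ 2 * X 4 * X 0 * X 1 + X 3 ^ 2 * X 0 * X 1 * X 2 + X 4 ^ 2 * X 1 * X 2 * X 3)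
      + C (a ^ 4) * (X 0 ^ 2 * X 2 ^ 2 * X 4 + X 1 ^ 2 * X 3 ^ 2 * X 0 + X 2 ^ 2 * X 4 ^ 2 * X 1
          + X 3 ^ 2 * X 0 ^ 2 * X 2 + X 4 ^ 2 * X 1 ^ 2 * X 3) := by
  have hmat : (Matrix.of fun i j => ∑ k : Fin 5, X k * C (Amat a a k i j)) =
      (!![X 0, C a * X 0, 0, 0, C a * X 4;
          C a * X 0, X 1, C a * X 1, 0, 0;
          0, C a * X 1, X 2, C a * X 2, 0;
          0, 0, C a * X 2, X 3, C a * X 3;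
          C a * X 4, 0, 0, C a * X 3, X 4] :
        Matrix (Fin 5) (Fin 5) (MvPolynomial (Fin 5) ℂ)) := by
    ext1 i j
    fin_cases i <;> fin_cases j <;> simp [Amat, Fin.sum_univ_five, mul_comm]
  have hC : (C 2 : MvPolynomial (Fin 5) ℂ) = 2 := map_ofNat C 2
  rw [Gquintic, hmat]
  simp [hC, det_succ_row_zero, Fin.sum_univ_succ, Fin.succAbove, Fin.succ, Fin.castSucc, submatrix]
  ring

/-- If all five 4×4 Pfaffians of `M(λ)` vanish at `λ`, then all five partial derivatives of
`G(λ) = det(λ₁A₁ + ⋯ + λ₅A₅)` (with `b = a`) vanish at `λ`: the elliptic normal quintic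
`C_E` lies in the singular locus of the special Hessian quintic `H_sp`. -/
theorem pfaffians_vanish_imp_singular_Hessian (a : ℂ) (ha : a ≠ 0)
    (hdisc : ∀ ζ η : ℂ, ζ ^ 5 = 1 → η ^ 5 = 1 → ζ * a + η * a + 1 ≠ 0)
    (l : Fin 5 → ℂ)
    (hPf1 : Mpf a l 1 2 * Mpf a l 3 4 - Mpf a l 1 3 * Mpf a l 2 4
              + Mpf a l 1 4 * Mpf a l 2 3 = 0)
    (hPf2 : Mpf a l 0 2 * Mpf a l 3 4 - Mpf a l 0 3 * Mpf a l 2 4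
              + Mpf a l 0 4 * Mpf a l 2 3 = 0)
    (hPf3 : Mpf a l 0 1 * Mpf a l 3 4 - Mpf a l 0 3 * Mpf a l 1 4
              + Mpf a l 0 4 * Mpf a l 1 3 = 0)
    (hPf4 : Mpf a l 0 1 * Mpf a l 2 4 - Mpf a l 0 2 * Mpf a l 1 4
              + Mpf a l 0 4 * Mpf a l 1 2 = 0)
    (hPf5 : Mpf a l 0 1 * Mpf a l 2 3 - Mpf a l 0 2 * Mpf a l 1 3
              + Mpf a l 0 3 * Mpf a l 1 2 = 0) :
    ∀ j : Fin 5, eval l (pderiv j (Gquintic a)) = 0 := by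
  simp only [Mpf, Matrix.of_apply, cons_val] at hPf1 hPf2 hPf3 hPf4 hPf5
  intro j
  rw [Gquintic_eq]
  fin_cases j <;>
    simp [Derivation.leibniz, Derivation.leibniz_pow, pderiv_X]
  · linear_combination (2 * a * l 2 * l 4 - 2 * a ^ 3 * l 2 * l 3) * hPf5
      - (2 * a ^ 2 * l 2 * l 4 + a * l 1 * l 3) * hPf3
      + (2 * l 1 * l 4 - a ^ 2 * l 1 * l 3) * hPf1 - l 1 * l 2 * hPf4
  · linear_combination (2 * a * l 3 * l 0 - 2 * a ^ 3 * l 3 * l 4) * hPf3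
      - (2 * a ^ 2 * l 3 * l 0 + a * l 2 * l 4) * hPf1
      + (2 * l 2 * l 0 - a ^ 2 * l 2 * l 4) * hPf4 - l 2 * l 3 * hPf2
  · linear_combination (2 * a * l 4 * l 1 - 2 * a ^ 3 * l 4 * l 0) * hPf1
      - (2 * a ^ 2 * l 4 * l 1 + a * l 3 * l 0) * hPf4
      + (2 * l 3 * l 1 - a ^ 2 * l 3 * l 0) * hPf2 - l 3 * l 4 * hPf5
  · linear_combination (2 * a * l 0 * l 2 - 2 * a ^ 3 * l 0 * l 1) * hPf4
      - (2 * a ^ 2 * l 0 * l 2 + a * l 4 * l 1) * hPf2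
      + (2 * l 4 * l 2 - a ^ 2 * l 4 * l 1) * hPf5 - l 4 * l 0 * hPf3
  · linear_combination (2 * a * l 1 * l 3 - 2 * a ^ 3 * l 1 * l 2) * hPf2
      - (2 * a ^ 2 * l 1 * l 3 + a * l 0 * l 2) * hPf5
      + (2 * l 0 * l 3 - a ^ 2 * l 0 * l 2) * hPf3 - l 0 * l 1 * hPf1
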